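/- arXiv:1602.06075 — 4 statements merged into one kernel-verified Lean document; each statement's English description precedes it below -/
import Mathlib

section
/- Let p be an odd prime, f ∈ ℤ_p[X] a polynomial of degree q ≥ 1, and x₀ ∈ ℤ with f(x₀) ≡ 0 (mod p) and f'(x₀) ≢ 0 (mod p). Define the Olver sequence (x_n) in ℚ_p by x_{n+1} = x_n − f(x_n)/f'(x_n) − (1/2)·[f(x_n)]²·f''(x_n)/[f'(x_n)]³. Then for every n ∈ ℕ: (a) x_n ∈ ℤ_p (i.e., |x_n|_p ≤ 1); (b) f'(x_n) ≢ 0 (mod p), i.e., |f'(x_n)|_p = 1; and (c) f(x_n) ≡ 0 (mod p^{3^n}), i.e., |f(x_n)|_p ≤ p^{−3^n}. -/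
open Polynomial Filter

/-- The Olver iteration sequence in `ℚ_[p]` for a polynomial `f ∈ ℤ_p[X]`,
starting from an integer `x₀`:
`x_{n+1} = x_n − f(x_n)/f'(x_n) − (1/2)·f(x_n)²·f''(x_n)/f'(x_n)³`. -/
noncomputable def olverSeq {p : ℕ} [Fact p.Prime] (f : Polynomial ℤ_[p]) (x₀ : ℤ) :
    ℕ → ℚ_[p]
  | 0 => (x₀ : ℚ_[p])
  | n + 1 =>
      olverSeq f x₀ n
        - aeval (olverSeq f x₀ n) f / aeval (olverSeq f x₀ n) (derivative f)
        - (1 / 2) * ((aeval (olverSeq f x₀ n) f) ^ 2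
            * aeval (olverSeq f x₀ n) (derivative (derivative f))
            / (aeval (olverSeq f x₀ n) (derivative f)) ^ 3)

/-- Third-order Taylor expansion of a polynomial over a commutative ring, with the second-order
coefficient given by half of the second derivative. -/
theorem Polynomial.exists_eval_add_eq_cubic {R : Type*} [CommRing R] (f : R[X]) (x : R) :
    ∃ c : R, 2 * c = (derivative (derivative f)).eval x ∧
      ∀ y : R, ∃ k : R,
        f.eval (x + y) = f.eval x + (derivative f).eval x * y + c * y ^ 2 + k * y ^ 3 := by
  refine ⟨(taylor x f).coeff 2, ?_, fun y ↦ ⟨(taylor x f).divX.divX.divX.eval y, ?_⟩⟩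
  · have h := congrArg (eval x) (congrFun (factorial_smul_hasseDeriv (R := R) 2) f)
    simpa [taylor_coeff, Nat.factorial] using h
  · have e (g : R[X]) : g.eval y = g.divX.eval y * y + g.coeff 0 := by
      conv_lhs => rw [← divX_mul_X_add g]
      simp
    rw [add_comm x y, ← taylor_eval, e (taylor x f), e (taylor x f).divX,
      e (taylor x f).divX.divX]
    simp only [coeff_divX, zero_add, Nat.reduceAdd, taylor_coeff_zero, taylor_coeff_one]
    ring

/-- One Olver step from a point with unit derivative (inverse `v`, half second derivative `c`)
moves by a multiple of the value of `f` and makes the new value divisible by its cube. -/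
theorem Polynomial.eval_pow_three_dvd_eval_olver_step {R : Type*} [CommRing R] (f : R[X])
    (x v : R) (hv : (derivative f).eval x * v = 1) :
    ∃ c y : R, 2 * c = (derivative (derivative f)).eval x ∧
      y = -(f.eval x * v) - c * (f.eval x) ^ 2 * v ^ 3 ∧
      (f.eval x) ^ 3 ∣ f.eval (x + y) := by
  obtain ⟨c, hc, hexp⟩ := f.exists_eval_add_eq_cubic x
  refine ⟨c, _, hc, rfl, ?_⟩
  obtain ⟨k, hk⟩ := hexp (-(f.eval x * v) - c * (f.eval x) ^ 2 * v ^ 3)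
  rw [hk]
  generalize f.eval x = a at *
  generalize (derivative f).eval x = u at *
  refine ⟨2 * c ^ 2 * v ^ 4 + c ^ 3 * a * v ^ 6 - k * v ^ 3 * (1 + c * a * v ^ 2) ^ 3, ?_⟩
  linear_combination (-a - c * a ^ 2 * v ^ 2) * hv

/-- Evaluation of an integral polynomial at a `p`-adic integer commutes with the coercion. -/
theorem PadicInt.aeval_coe {p : ℕ} [Fact p.Prime] (f : ℤ_[p][X]) (z : ℤ_[p]) :
    aeval (z : ℚ_[p]) f = ((f.eval z : ℤ_[p]) : ℚ_[p]) :=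
  aeval_algebraMap_apply_eq_algebraMap_eval z f

theorem PadicInt.norm_eq_one_of_not_dvd {p : ℕ} [Fact p.Prime] {z : ℤ_[p]}
    (hz : ¬ (p : ℤ_[p]) ∣ z) : ‖z‖ = 1 :=
  le_antisymm z.norm_le_one (not_lt.1 fun h ↦ hz (PadicInt.norm_lt_one_iff_dvd z |>.1 h))

/-- The Olver iterates are `p`-adic integers at which `f'` is a unit and `f` vanishes modulo
`p ^ 3 ^ n`. -/
theorem olverSeq_exists_padicInt {p : ℕ} [Fact p.Prime] (f : ℤ_[p][X]) (x₀ : ℤ)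
    (h0 : (p : ℤ_[p]) ∣ f.eval (x₀ : ℤ_[p]))
    (h1 : ¬ (p : ℤ_[p]) ∣ (derivative f).eval (x₀ : ℤ_[p])) (n : ℕ) :
    ∃ z : ℤ_[p], olverSeq f x₀ n = z ∧ ¬ (p : ℤ_[p]) ∣ (derivative f).eval z ∧
      (p : ℤ_[p]) ^ 3 ^ n ∣ f.eval z := by
  induction n with
  | zero => exact ⟨x₀, by simp [olverSeq], h1, by simpa using h0⟩
  | succ n ih =>
    obtain ⟨z, hz, hd, hf⟩ := ih
    obtain ⟨v, hv⟩ := (PadicInt.isUnit_iff.2 (PadicInt.norm_eq_one_of_not_dvd hd)).exists_right_inv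
    obtain ⟨c, y, hc, hy, hdvd⟩ := f.eval_pow_three_dvd_eval_olver_step z v hv
    refine ⟨z + y, ?_, fun h ↦ hd ?_, ?_⟩
    · have hv' : (((derivative f).eval z : ℤ_[p]) : ℚ_[p]) * v = 1 := by
        rw [← PadicInt.coe_mul, hv, PadicInt.coe_one]
      have hc' : (2 : ℚ_[p]) * c = (((derivative (derivative f)).eval z : ℤ_[p]) : ℚ_[p]) := by
        rw [← hc]; push_cast; rfl
      rw [olverSeq, hz, PadicInt.aeval_coe, PadicInt.aeval_coe, PadicInt.aeval_coe, ← hc',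
        eq_inv_of_mul_eq_one_left hv', hy]
      push_cast
      field_simp
      ring
    · have hpy : (p : ℤ_[p]) ∣ y := by
        have hpf := (dvd_pow_self (p : ℤ_[p]) (pow_ne_zero n three_ne_zero)).trans hf
        rw [hy]
        exact dvd_sub (hpf.mul_right v).neg_right
          (((hpf.trans (dvd_pow_self _ two_ne_zero)).mul_left c).mul_right _)
      have hsub := hpy.trans (by simpa using sub_dvd_eval_sub (z + y) z (derivative f))
      exact (dvd_sub_right h).1 hsub
    · rw [pow_succ, pow_mul]
      exact (pow_dvd_pow_of_dvd hf 3).trans hdvd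

/-- For an odd prime `p`, a polynomial `f ∈ ℤ_p[X]` of degree `q ≥ 1`, and an integer
starting point `x₀` with `f(x₀) ≡ 0 (mod p)` and `f'(x₀) ≢ 0 (mod p)`, every Olver
iterate `x_n` lies in `ℤ_p`, satisfies `|f'(x_n)|_p = 1`, and `|f(x_n)|_p ≤ p^{-3^n}`. -/
theorem olver_iterates_odd_prime (p : ℕ) [Fact p.Prime] (hp2 : p ≠ 2)
    (f : Polynomial ℤ_[p]) (hdeg : 1 ≤ f.natDegree) (x₀ : ℤ)
    (h0 : (p : ℤ_[p]) ∣ f.eval (x₀ : ℤ_[p]))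
    (h1 : ¬ (p : ℤ_[p]) ∣ (derivative f).eval (x₀ : ℤ_[p])) :
    ∀ n : ℕ,
      ‖olverSeq f x₀ n‖ ≤ 1 ∧
      ‖aeval (olverSeq f x₀ n) (derivative f)‖ = 1 ∧
      ‖aeval (olverSeq f x₀ n) f‖ ≤ (p : ℝ) ^ (-(3 ^ n : ℤ)) := by
  intro n
  obtain ⟨z, hz, hd, hf⟩ := olverSeq_exists_padicInt f x₀ h0 h1 n
  rw [hz, PadicInt.aeval_coe, PadicInt.aeval_coe]
  refine ⟨z.norm_le_one, PadicInt.norm_eq_one_of_not_dvd hd, ?_⟩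
  have h := (PadicInt.norm_le_pow_iff_mem_span_pow _ _).2 (Ideal.mem_span_singleton.2 hf)
  simpa using h
end

section
/- Let p be an odd prime, f ∈ ℤ_p[X] a polynomial of degree q ≥ 1, and x₀ ∈ ℤ with f(x₀) ≡ 0 (mod p) and f'(x₀) ≢ 0 (mod p), and let (x_n) be the Olver sequence. Then for every n ∈ ℕ, |x_{n+1} − x_n|_p ≤ p^{−3^n}; in particular (x_n) is a Cauchy sequence in ℚ_p. -/
open Polynomial Filter

theorem Polynomial.exists_eval_add_eq_cubic_remainder {R : Type*} [CommRing R] (f : R[X])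
    (a h : R) :
    ∃ c r : R, 2 * c = (derivative (derivative f)).eval a ∧
      f.eval (a + h) = f.eval a + (derivative f).eval a * h + c * h ^ 2 + r * h ^ 3 := by
  refine ⟨(taylor a f).coeff 2, ((taylor a f).divX.divX.divX).eval h, ?_, ?_⟩
  · have h2 := congrArg (eval a) (congrFun (factorial_smul_hasseDeriv (R := R) 2) f)
    simpa [taylor_coeff, Nat.factorial] using h2
  · have h3 : (taylor a f).eval h = f.eval (a + h) := by rw [taylor_eval, add_comm]
    rw [← h3, ← taylor_coeff_zero a f, ← taylor_coeff_one a f]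
    conv_lhs =>
      rw [← divX_mul_X_add (taylor a f), ← divX_mul_X_add (taylor a f).divX,
        ← divX_mul_X_add (taylor a f).divX.divX]
    simp only [eval_add, eval_mul, eval_X, eval_C, coeff_divX]
    ring

/-- One Olver step at a point where `f'` is invertible cubes the order of vanishing of `f`. -/
theorem Polynomial.pow_three_dvd_eval_olver_step {R : Type*} [CommRing R] (f : R[X])
    {a u t : R} (hu : (derivative f).eval a * u = 1) (ht : 2 * t = 1) :
    f.eval a ^ 3 ∣ f.eval (a + (-(f.eval a * u) -
      t * (f.eval a ^ 2 * (derivative (derivative f)).eval a * u ^ 3))) := by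
  obtain ⟨c, r, hc, hr⟩ := f.exists_eval_add_eq_cubic_remainder a (-(f.eval a * u) -
      t * (f.eval a ^ 2 * (derivative (derivative f)).eval a * u ^ 3))
  rw [hr, ← hc]
  generalize f.eval a = y at *
  generalize (derivative f).eval a = d at *
  have e : t * (y ^ 2 * (2 * c) * u ^ 3) = c * y ^ 2 * u ^ 3 := by
    linear_combination c * y ^ 2 * u ^ 3 * ht
  rw [e]
  refine ⟨2 * c ^ 2 * u ^ 4 + y * c ^ 3 * u ^ 6 + r * (-u - c * y * u ^ 3) ^ 3, ?_⟩
  linear_combination (-y - c * y ^ 2 * u ^ 2) * hu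

theorem PadicInt.isUnit_iff_not_dvd {p : ℕ} [Fact p.Prime] {x : ℤ_[p]} :
    IsUnit x ↔ ¬ (p : ℤ_[p]) ∣ x := by
  rw [← PadicInt.norm_lt_one_iff_dvd, PadicInt.isUnit_iff, not_lt]
  exact ⟨fun h => h.ge, fun h => le_antisymm x.norm_le_one h⟩

theorem PadicInt.isUnit_two {p : ℕ} [Fact p.Prime] (hp2 : p ≠ 2) : IsUnit (2 : ℤ_[p]) := by
  rw [PadicInt.isUnit_iff]
  have h := (PadicInt.norm_natCast_eq_one_iff (p := p) (n := 2)).2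
    ((Nat.coprime_primes Fact.out Nat.prime_two).2 hp2)
  exact_mod_cast h

theorem aeval_padicInt_coe {p : ℕ} [Fact p.Prime] (f : ℤ_[p][X]) (a : ℤ_[p]) :
    aeval (a : ℚ_[p]) f = (f.eval a : ℤ_[p]) :=
  aeval_algebraMap_apply_eq_algebraMap_eval a f

theorem exists_padicInt_olver_step {p : ℕ} [Fact p.Prime] (hp2 : p ≠ 2) (f : ℤ_[p][X])
    {m : ℕ} (hm : m ≠ 0) {a : ℤ_[p]} (h0 : (p : ℤ_[p]) ^ m ∣ f.eval a)
    (h1 : ¬ (p : ℤ_[p]) ∣ (derivative f).eval a) :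
    ∃ b : ℤ_[p],
      (b : ℚ_[p]) = a - aeval (a : ℚ_[p]) f / aeval (a : ℚ_[p]) (derivative f)
        - (1 / 2) * ((aeval (a : ℚ_[p]) f) ^ 2 * aeval (a : ℚ_[p]) (derivative (derivative f))
            / (aeval (a : ℚ_[p]) (derivative f)) ^ 3) ∧
      (p : ℤ_[p]) ^ m ∣ b - a ∧ (p : ℤ_[p]) ^ (m * 3) ∣ f.eval b ∧
      ¬ (p : ℤ_[p]) ∣ (derivative f).eval b := by
  obtain ⟨u, hu⟩ := (PadicInt.isUnit_iff_not_dvd.2 h1).exists_right_inv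
  obtain ⟨t, ht⟩ := (PadicInt.isUnit_two hp2).exists_right_inv
  have hba : (p : ℤ_[p]) ^ m ∣ (a + (-(f.eval a * u) -
      t * (f.eval a ^ 2 * (derivative (derivative f)).eval a * u ^ 3))) - a := by
    rw [add_sub_cancel_left]
    refine h0.trans ⟨-u - t * (f.eval a * (derivative (derivative f)).eval a * u ^ 3), ?_⟩
    ring
  refine ⟨_, ?_, hba, ?_, fun hb => h1 ?_⟩
  · have hu' : ((u : ℤ_[p]) : ℚ_[p]) = (((derivative f).eval a : ℤ_[p]) : ℚ_[p])⁻¹ :=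
      eq_inv_of_mul_eq_one_right (by exact_mod_cast congrArg ((↑) : ℤ_[p] → ℚ_[p]) hu)
    have ht' : ((t : ℤ_[p]) : ℚ_[p]) = 2⁻¹ :=
      eq_inv_of_mul_eq_one_right (by exact_mod_cast congrArg ((↑) : ℤ_[p] → ℚ_[p]) ht)
    simp only [aeval_padicInt_coe]
    push_cast
    rw [hu', ht']
    ring
  · rw [pow_mul]
    exact (pow_dvd_pow_of_dvd h0 3).trans (f.pow_three_dvd_eval_olver_step hu ht)
  · refine (dvd_sub_right hb).1 ?_
    exact ((dvd_pow_self _ hm).trans hba).trans (sub_dvd_eval_sub _ _ _)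

theorem exists_padicInt_eq_olverSeq {p : ℕ} [Fact p.Prime] (hp2 : p ≠ 2) (f : ℤ_[p][X]) (x₀ : ℤ)
    (h0 : (p : ℤ_[p]) ∣ f.eval (x₀ : ℤ_[p]))
    (h1 : ¬ (p : ℤ_[p]) ∣ (derivative f).eval (x₀ : ℤ_[p])) (n : ℕ) :
    ∃ a : ℤ_[p], (a : ℚ_[p]) = olverSeq f x₀ n ∧ (p : ℤ_[p]) ^ 3 ^ n ∣ f.eval a ∧
      ¬ (p : ℤ_[p]) ∣ (derivative f).eval a := by
  induction n with
  | zero => exact ⟨x₀, by simp [olverSeq], by simpa using h0, h1⟩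
  | succ n ih =>
    obtain ⟨a, ha, hf, hd⟩ := ih
    obtain ⟨b, hb, -, hfb, hdb⟩ := exists_padicInt_olver_step hp2 f (by positivity) hf hd
    exact ⟨b, by rw [hb, ha, olverSeq], by rwa [pow_succ], hdb⟩

/-- For an odd prime `p`, under the standard hypotheses on `f` and `x₀`, consecutive
Olver iterates satisfy `|x_{n+1} − x_n|_p ≤ p^{-3^n}`; in particular the sequence
`(x_n)` is Cauchy in `ℚ_p`. -/
theorem olver_cauchy_odd_prime (p : ℕ) [Fact p.Prime] (hp2 : p ≠ 2)
    (f : Polynomial ℤ_[p]) (hdeg : 1 ≤ f.natDegree) (x₀ : ℤ)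
    (h0 : (p : ℤ_[p]) ∣ f.eval (x₀ : ℤ_[p]))
    (h1 : ¬ (p : ℤ_[p]) ∣ (derivative f).eval (x₀ : ℤ_[p])) :
    (∀ n : ℕ, ‖olverSeq f x₀ (n + 1) - olverSeq f x₀ n‖ ≤ (p : ℝ) ^ (-(3 ^ n : ℤ))) ∧
      CauchySeq (olverSeq f x₀) := by
  have hp : 1 < (p : ℝ) := by exact_mod_cast (Fact.out : p.Prime).one_lt
  have key : ∀ n : ℕ,
      ‖olverSeq f x₀ (n + 1) - olverSeq f x₀ n‖ ≤ (p : ℝ) ^ (-(3 ^ n : ℤ)) := by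
    intro n
    obtain ⟨a, ha, hf, hd⟩ := exists_padicInt_eq_olverSeq hp2 f x₀ h0 h1 n
    obtain ⟨b, hb, hba, -⟩ := exists_padicInt_olver_step hp2 f (by positivity) hf hd
    have hn := (PadicInt.norm_le_pow_iff_mem_span_pow (b - a) (3 ^ n)).2
      (Ideal.mem_span_singleton.2 hba)
    rw [PadicInt.norm_def, PadicInt.coe_sub, hb, ha] at hn
    rw [olverSeq]
    exact_mod_cast hn
  refine ⟨key, cauchySeq_of_le_geometric (p : ℝ)⁻¹ 1 (inv_lt_one_of_one_lt₀ hp) fun n => ?_⟩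
  rw [dist_comm, dist_eq_norm, one_mul, inv_pow, ← zpow_natCast, ← zpow_neg]
  refine (key n).trans (zpow_le_zpow_right₀ hp.le (neg_le_neg ?_))
  exact_mod_cast (Nat.lt_pow_self (by norm_num : 1 < 3)).le
end

section
/- Let p be a prime, f ∈ ℤ_p[X] a polynomial of degree q ≥ 1, and x₀ ∈ ℤ with f(x₀) ≡ 0 (mod p) and f'(x₀) ≢ 0 (mod p), and let (x_n) be the Olver sequence. Then (x_n) converges in ℚ_p to a limit ξ ∈ ℤ_p satisfying f(ξ) = 0 and ξ ≡ x₀ (mod p); moreover ξ is the unique element of ℤ_p with f(ξ) = 0 and ξ ≡ x₀ (mod p). -/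
open Polynomial Filter

/-- Evaluating an integral polynomial at a `p`-adic integer gives the same value in `ℤ_[p]` and in
`ℚ_[p]`. -/
lemma aeval_coe_padicInt {p : ℕ} [Fact p.Prime] (f : Polynomial ℤ_[p]) (a : ℤ_[p]) :
    aeval (a : ℚ_[p]) f = ((f.eval a : ℤ_[p]) : ℚ_[p]) := by
  have h := aeval_algebraMap_apply ℚ_[p] a f
  rwa [coe_aeval_eq_eval] at h

/-- The second derivative is twice the second Hasse derivative. -/
lemma eval_derivative_derivative_eq_two_mul {R : Type*} [CommRing R] (f : Polynomial R) (a : R) :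
    (derivative (derivative f)).eval a = 2 * (hasseDeriv 2 f).eval a := by
  have h := congrArg (fun g : Polynomial R → Polynomial R => (g f).eval a)
    (factorial_smul_hasseDeriv (R := R) 2)
  simpa using h.symm

/-- One Olver step at an approximation `a` of a root `ξ` squares the error, up to an integral
factor, as soon as `f'(a)` has an inverse `v`. -/
lemma sq_sub_dvd_olver_step {R : Type*} [CommRing R] (f : Polynomial R) {a ξ v : R} (h : R)
    (hξ : f.eval ξ = 0) (hv : (derivative f).eval a * v = 1) :
    (a - ξ) ^ 2 ∣ a - f.eval a * v - f.eval a ^ 2 * h * v ^ 3 - ξ := by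
  obtain ⟨c, hc⟩ := f.binomExpansion a (ξ - a)
  rw [add_sub_cancel, hξ] at hc
  have hf : f.eval a = (a - ξ) * ((derivative f).eval a - c * (a - ξ)) := by
    linear_combination -hc
  refine ⟨c * v - ((derivative f).eval a - c * (a - ξ)) ^ 2 * h * v ^ 3, ?_⟩
  rw [hf]
  linear_combination -(a - ξ) * hv

/-- The Olver step at a `p`-adic integer where `f'` is invertible is a `p`-adic integer. -/
lemma olverSeq_succ_eq_coe {p : ℕ} [Fact p.Prime] (f : Polynomial ℤ_[p]) (x₀ : ℤ) {n : ℕ}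
    {a v : ℤ_[p]} (ha : olverSeq f x₀ n = a) (hv : (derivative f).eval a * v = 1) :
    olverSeq f x₀ (n + 1) =
      ((a - f.eval a * v - f.eval a ^ 2 * (hasseDeriv 2 f).eval a * v ^ 3 : ℤ_[p]) : ℚ_[p]) := by
  have hv' : (((derivative f).eval a : ℤ_[p]) : ℚ_[p]) * v = 1 := by
    rw [← PadicInt.coe_mul, hv, PadicInt.coe_one]
  have hv_eq : (v : ℚ_[p]) = (((derivative f).eval a : ℤ_[p]) : ℚ_[p])⁻¹ :=
    eq_inv_of_mul_eq_one_right hv'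
  rw [olverSeq, ha]
  simp only [aeval_coe_padicInt, eval_derivative_derivative_eq_two_mul]
  push_cast
  rw [hv_eq]
  have h2 : ((2 : ℤ_[p]) : ℚ_[p]) = 2 := by norm_cast
  simp only [h2, div_eq_mul_inv, inv_pow]
  ring

/-- If `p ∤ g(b)` and `a ≡ b (mod p)`, then `g(a)` is a unit. -/
lemma PadicInt.isUnit_eval_of_dvd_sub {p : ℕ} [Fact p.Prime] (g : Polynomial ℤ_[p])
    {a b : ℤ_[p]} (hab : (p : ℤ_[p]) ∣ a - b) (hb : ¬ (p : ℤ_[p]) ∣ g.eval b) :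
    IsUnit (g.eval a) := by
  have ha : ¬ (p : ℤ_[p]) ∣ g.eval a := fun h =>
    hb ((dvd_sub_right h).1 (hab.trans (sub_dvd_eval_sub a b g)))
  by_contra hu
  rw [← mem_nonunits_iff, PadicInt.mem_nonunits, PadicInt.norm_lt_one_iff_dvd] at hu
  exact ha hu

/-- For any prime `p`, under the standard hypotheses on `f` and `x₀`, the Olver
sequence converges in `ℚ_p` to a limit `ξ ∈ ℤ_p` with `f(ξ) = 0` and
`ξ ≡ x₀ (mod p)`, and `ξ` is the unique such zero of `f` in `ℤ_p`. -/
theorem olver_converges_to_unique_root (p : ℕ) [Fact p.Prime]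
    (f : Polynomial ℤ_[p]) (hdeg : 1 ≤ f.natDegree) (x₀ : ℤ)
    (h0 : (p : ℤ_[p]) ∣ f.eval (x₀ : ℤ_[p]))
    (h1 : ¬ (p : ℤ_[p]) ∣ (derivative f).eval (x₀ : ℤ_[p])) :
    ∃ ξ : ℤ_[p],
      Filter.Tendsto (olverSeq f x₀) Filter.atTop (nhds (ξ : ℚ_[p])) ∧
      f.eval ξ = 0 ∧
      (p : ℤ_[p]) ∣ (ξ - (x₀ : ℤ_[p])) ∧
      ∀ ξ' : ℤ_[p], f.eval ξ' = 0 → (p : ℤ_[p]) ∣ (ξ' - (x₀ : ℤ_[p])) → ξ' = ξ := by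
  have hu : ‖(derivative f).eval (x₀ : ℤ_[p])‖ = 1 :=
    PadicInt.isUnit_iff.1 (PadicInt.isUnit_eval_of_dvd_sub _ (by simp) h1)
  obtain ⟨ξ, hξ, hξx, -, huniq⟩ := hensels_lemma (F := f) (a := (x₀ : ℤ_[p])) (by
    simpa only [coe_aeval_eq_eval, hu, one_pow, PadicInt.norm_lt_one_iff_dvd] using h0)
  simp only [coe_aeval_eq_eval, hu, PadicInt.norm_lt_one_iff_dvd] at hξ hξx huniq
  refine ⟨ξ, ?_, hξ, hξx, huniq⟩
  have key : ∀ n, ∃ a : ℤ_[p], olverSeq f x₀ n = a ∧ (p : ℤ_[p]) ^ (n + 1) ∣ a - ξ := by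
    intro n
    induction n with
    | zero => exact ⟨x₀, by simp [olverSeq], by rw [zero_add, pow_one]; exact dvd_sub_comm.1 hξx⟩
    | succ n ih =>
      obtain ⟨a, ha, hd⟩ := ih
      have hdp : (p : ℤ_[p]) ∣ a - ξ := (dvd_pow_self _ n.succ_ne_zero).trans hd
      obtain ⟨v, hv⟩ := (PadicInt.isUnit_eval_of_dvd_sub (derivative f)
        (by simpa using dvd_add hdp hξx) h1).exists_right_inv
      refine ⟨_, olverSeq_succ_eq_coe f x₀ ha hv, ?_⟩
      refine dvd_trans ?_ (sq_sub_dvd_olver_step f _ hξ hv)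
      rw [pow_succ, sq]
      exact mul_dvd_mul hd hdp
  rw [tendsto_iff_norm_sub_tendsto_zero]
  have hp : 1 < (p : ℝ) := by exact_mod_cast (Fact.out : p.Prime).one_lt
  refine squeeze_zero (fun _ => norm_nonneg _) (fun n => ?_)
    ((tendsto_pow_atTop_nhds_zero_of_lt_one (by positivity) (inv_lt_one_of_one_lt₀ hp)).comp
      (tendsto_add_atTop_nat 1))
  obtain ⟨a, ha, c, hc⟩ := key n
  rw [ha, ← PadicInt.coe_sub, PadicInt.padic_norm_e_of_padicInt, hc, norm_mul, norm_pow,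
    PadicInt.norm_p]
  exact mul_le_of_le_one_right (by positivity) c.norm_le_one
end

section
/- Let p be a prime and let f be a polynomial with integer coefficients. Then f has a root in the ring ℤ_p of p-adic integers if and only if for every positive integer m there exists an integer x such that f(x) ≡ 0 (mod p^m). -/
open Polynomial

theorem PadicInt.aeval_intCast (p : ℕ) [Fact p.Prime] (f : Polynomial ℤ) (x : ℤ) :
    aeval (x : ℤ_[p]) f = ((f.eval x : ℤ) : ℤ_[p]) := by
  simpa using aeval_algebraMap_apply ℤ_[p] x f

/-- A polynomial with integer coefficients has a root in the ring `ℤ_p` of `p`-adic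
integers if and only if for every positive integer `m` it has an integer root
modulo `p^m`. -/
theorem padic_root_iff_root_mod_prime_powers (p : ℕ) [Fact p.Prime]
    (f : Polynomial ℤ) :
    (∃ ξ : ℤ_[p], aeval ξ f = 0) ↔
      ∀ m : ℕ, 0 < m → ∃ x : ℤ, ((p : ℤ) ^ m) ∣ f.eval x := by
  constructor
  · rintro ⟨ξ, hξ⟩ m -
    refine ⟨ξ.appr m, (PadicInt.pow_p_dvd_int_iff m _).1 ?_⟩
    rw [← PadicInt.aeval_intCast, ← dvd_neg, ← zero_sub, ← hξ, aeval_def, aeval_def,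
      ← eval_map, ← eval_map]
    refine dvd_trans ?_ (sub_dvd_eval_sub _ _ _)
    simpa using Ideal.mem_span_singleton.1 (PadicInt.appr_spec m ξ)
  · intro h
    obtain ⟨ξ, hξ⟩ := (show Continuous fun y : ℤ_[p] => ‖aeval y f‖ from
      (f.continuous_aeval).norm).exists_forall_le_of_isBounded 0 (isCompact_univ.isBounded.subset
        (Set.subset_univ _))
    refine ⟨ξ, by_contra fun hne => ?_⟩
    obtain ⟨k, hk⟩ := PadicInt.exists_pow_neg_lt p (norm_pos_iff.2 hne)
    obtain ⟨x, hx⟩ := h (k + 1) k.succ_pos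
    have hle := hξ (x : ℤ_[p])
    rw [PadicInt.aeval_intCast] at hle
    have hx' : ((p ^ k : ℕ) : ℤ) ∣ f.eval x := by
      push_cast
      exact (pow_dvd_pow _ k.le_succ).trans hx
    exact (hle.trans (PadicInt.norm_int_le_pow_iff_dvd.2 (by simpa using hx'))).not_gt hk
end
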